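/- arXiv:1202.4198 — 3 statements merged into one kernel-verified Lean document; each statement's English description precedes it below -/
import Mathlib

section
/- Let a, b, c, d be real numbers with a < b and c < d, and let X be the 2×2 matrix with rows (a, b) and (c, d). Then the row standardization of X is the matrix with both rows equal to (−1, 1); consequently both columns of the row-standardized matrix are constant and have standard deviation 0, so column standardization of the result is undefined. -/
open Filter MeasureTheory Finset

/-- Mean of the `i`-th row of an `I × J` matrix. -/
noncomputable def rowMean {I J : ℕ} (X : Fin I → Fin J → ℝ) (i : Fin I) : ℝ :=
  (∑ j, X i j) / J

/-- Standard deviation (with divisor `J`) of the `i`-th row. -/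
noncomputable def rowSD {I J : ℕ} (X : Fin I → Fin J → ℝ) (i : Fin I) : ℝ :=
  Real.sqrt ((∑ j, (X i j - rowMean X i) ^ 2) / J)

/-- Row standardization `R(X)`. -/
noncomputable def rowStd {I J : ℕ} (X : Fin I → Fin J → ℝ) : Fin I → Fin J → ℝ :=
  fun i j => (X i j - rowMean X i) / rowSD X i

/-- Mean of the `j`-th column. -/
noncomputable def colMean {I J : ℕ} (X : Fin I → Fin J → ℝ) (j : Fin J) : ℝ :=
  (∑ i, X i j) / I

/-- Standard deviation (with divisor `I`) of the `j`-th column. -/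
noncomputable def colSD {I J : ℕ} (X : Fin I → Fin J → ℝ) (j : Fin J) : ℝ :=
  Real.sqrt ((∑ i, (X i j - colMean X j) ^ 2) / I)

/-- Column standardization `C(X)`. -/
noncomputable def colStd {I J : ℕ} (X : Fin I → Fin J → ℝ) : Fin I → Fin J → ℝ :=
  fun i j => (X i j - colMean X j) / colSD X j

/-- Efron's algorithm: `X⁽⁰⁾ = X`, `X⁽²ᵐ⁺¹⁾ = R(X⁽²ᵐ⁾)`, `X⁽²ᵐ⁺²⁾ = C(X⁽²ᵐ⁺¹⁾)`. -/
noncomputable def efron {I J : ℕ} (X : Fin I → Fin J → ℝ) : ℕ → (Fin I → Fin J → ℝ)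
  | 0 => X
  | (m + 1) => if m % 2 = 0 then rowStd (efron X m) else colStd (efron X m)

/-- All iterates of Efron's algorithm are defined: every intermediate row (resp. column)
standard deviation that is used by the algorithm is strictly positive. -/
def efronDefined {I J : ℕ} (X : Fin I → Fin J → ℝ) : Prop :=
  ∀ m : ℕ, (m % 2 = 0 → ∀ i, 0 < rowSD (efron X m) i) ∧
    (m % 2 = 1 → ∀ j, 0 < colSD (efron X m) j)

theorem rowMean_two {I : ℕ} (X : Fin I → Fin 2 → ℝ) (i : Fin I) :
    rowMean X i = (X i 0 + X i 1) / 2 := by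
  simp [rowMean, Fin.sum_univ_two]

theorem rowSD_two {I : ℕ} (X : Fin I → Fin 2 → ℝ) {i : Fin I} (h : X i 0 ≤ X i 1) :
    rowSD X i = (X i 1 - X i 0) / 2 := by
  rw [rowSD, rowMean_two, Fin.sum_univ_two, Real.sqrt_eq_iff_mul_self_eq (by positivity)
    (by linarith)]
  push_cast
  ring

theorem rowStd_two {I : ℕ} (X : Fin I → Fin 2 → ℝ) {i : Fin I} (h : X i 0 < X i 1) :
    rowStd X i = ![-1, 1] := by
  have hne : X i 1 - X i 0 ≠ 0 := (sub_pos.2 h).ne'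
  ext j
  rw [rowStd, rowSD_two X h.le, rowMean_two]
  fin_cases j <;> simp <;> field_simp <;> ring

theorem colSD_eq_zero_of_const {I J : ℕ} (X : Fin I → Fin J → ℝ) (j : Fin J)
    (h : ∀ i i', X i j = X i' j) : colSD X j = 0 := by
  have hmean (i : Fin I) : X i j = colMean X j := by
    have hI : (I : ℝ) ≠ 0 := Nat.cast_ne_zero.2 i.pos.ne'
    rw [colMean, Finset.sum_congr rfl fun i' _ => h i' i]
    simp [hI]
  simp [colSD, hmean]

/-- For a `2 × 2` matrix with increasing rows `(a,b)`, `(c,d)`, the row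
standardization has both rows equal to `(−1, 1)`, so both columns of the result are
constant with standard deviation `0`, and column standardization is undefined. -/
theorem two_by_two_row_standardization (a b c d : ℝ) (hab : a < b) (hcd : c < d) :
    (∀ i, 0 < rowSD ![![a, b], ![c, d]] i) ∧
    rowStd ![![a, b], ![c, d]] = ![![(-1 : ℝ), 1], ![(-1 : ℝ), 1]] ∧
    (∀ j, ∀ i i', rowStd ![![a, b], ![c, d]] i j = rowStd ![![a, b], ![c, d]] i' j) ∧
    (∀ j, colSD (rowStd ![![a, b], ![c, d]]) j = 0) := by
  have hlt (i : Fin 2) :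
      (![![a, b], ![c, d]] : Fin 2 → Fin 2 → ℝ) i 0 < ![![a, b], ![c, d]] i 1 := by
    fin_cases i <;> simpa
  have hconst (j i i' : Fin 2) :
      rowStd ![![a, b], ![c, d]] i j = rowStd ![![a, b], ![c, d]] i' j := by
    rw [rowStd_two _ (hlt i), rowStd_two _ (hlt i')]
  refine ⟨fun i => ?_, ?_, hconst, fun j => colSD_eq_zero_of_const _ j (hconst j)⟩
  · rw [rowSD_two _ (hlt i).le]
    exact half_pos (sub_pos.2 (hlt i))
  · funext i
    rw [rowStd_two _ (hlt i)]
    fin_cases i <;> rfl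
end

section
/- Let I be an odd positive integer. There is no I×2 real matrix Y such that every row of Y has mean 0 and variance 1 (i.e., (1/2)(Y_{i1}+Y_{i2}) = 0 and (1/2)(Y_{i1}²+Y_{i2}²) = 1 for all i) and every column of Y has mean 0. In fact, for any such row-standardized Y, each column mean has absolute value at least 1/I. Consequently no doubly standardized I×2 matrix exists when I is odd. -/
open Filter MeasureTheory Finset

/-- A sum of signs over a finset differs from the cardinality by an even integer. -/
theorem exists_sum_eq_card_sub_two_mul {ι : Type*} (s : Finset ι) (f : ι → ℝ)
    (hf : ∀ i ∈ s, f i = 1 ∨ f i = -1) : ∃ k : ℤ, ∑ i ∈ s, f i = s.card - 2 * k := by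
  induction s using Finset.cons_induction with
  | empty => exact ⟨0, by simp⟩
  | cons a s ha ih =>
    obtain ⟨k, hk⟩ := ih fun i hi => hf i (Finset.mem_cons_of_mem hi)
    rw [Finset.sum_cons, Finset.card_cons, hk]
    rcases hf a (Finset.mem_cons_self a s) with h | h
    · exact ⟨k, by rw [h]; push_cast; ring⟩
    · exact ⟨k + 1, by rw [h]; push_cast; ring⟩

/-- An odd number of signs has a sum of absolute value at least one. -/
theorem one_le_abs_sum_of_odd_card {ι : Type*} (s : Finset ι) (f : ι → ℝ)
    (hf : ∀ i ∈ s, f i = 1 ∨ f i = -1) (hs : Odd s.card) : 1 ≤ |∑ i ∈ s, f i| := by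
  obtain ⟨k, hk⟩ := exists_sum_eq_card_sub_two_mul s f hf
  have hne : (s.card : ℤ) - 2 * k ≠ 0 := by
    obtain ⟨m, hm⟩ := hs
    omega
  rw [hk]
  exact_mod_cast Int.one_le_abs hne

/-- The entries of a two-column matrix with standardized rows are signs. -/
theorem eq_one_or_eq_neg_one_of_row {I : ℕ} {Y : Fin I → Fin 2 → ℝ} {i : Fin I}
    (h : (Y i 0 + Y i 1) / 2 = 0 ∧ ((Y i 0) ^ 2 + (Y i 1) ^ 2) / 2 = 1) (j : Fin 2) :
    Y i j = 1 ∨ Y i j = -1 := by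
  obtain ⟨h₁, h₂⟩ := h
  have h₀ : Y i 1 = -Y i 0 := by linarith
  rw [h₀] at h₂
  have hsq : Y i j ^ 2 = 1 := by
    fin_cases j
    · simp only [Fin.zero_eta]
      linarith
    · simp only [Fin.mk_one, h₀]
      linarith
  simpa using hsq

/-- For odd `I`, any `I × 2` matrix whose rows all have mean 0 and
variance 1 has both column means of absolute value at least `1/I`; hence no such matrix
has all column means 0, and no doubly standardized `I × 2` matrix exists. -/
theorem no_doubly_standardized_odd_by_two {I : ℕ} (hI : Odd I) :
    (∀ Y : Fin I → Fin 2 → ℝ,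
      (∀ i, (Y i 0 + Y i 1) / 2 = 0 ∧ ((Y i 0) ^ 2 + (Y i 1) ^ 2) / 2 = 1) →
        ∀ j, 1 / (I : ℝ) ≤ |colMean Y j|) ∧
    ¬ ∃ Y : Fin I → Fin 2 → ℝ,
        (∀ i, rowMean Y i = 0) ∧ (∀ j, colMean Y j = 0) ∧
        (∀ i, (∑ j, (Y i j - rowMean Y i) ^ 2) / 2 = 1) ∧
        (∀ j, (∑ i, (Y i j - colMean Y j) ^ 2) / I = 1) := by
  have hpos : (0 : ℝ) < I := by exact_mod_cast hI.pos
  have hmain : ∀ Y : Fin I → Fin 2 → ℝ,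
      (∀ i, (Y i 0 + Y i 1) / 2 = 0 ∧ ((Y i 0) ^ 2 + (Y i 1) ^ 2) / 2 = 1) →
        ∀ j, 1 / (I : ℝ) ≤ |colMean Y j| := by
    intro Y hY j
    have hsum := one_le_abs_sum_of_odd_card Finset.univ (fun i => Y i j)
      (fun i _ => eq_one_or_eq_neg_one_of_row (hY i) j) (by simpa using hI)
    rw [colMean, abs_div, abs_of_pos hpos]
    gcongr
  refine ⟨hmain, ?_⟩
  rintro ⟨Y, hrow, hcol, hvar, -⟩
  have hstd : ∀ i, (Y i 0 + Y i 1) / 2 = 0 ∧ ((Y i 0) ^ 2 + (Y i 1) ^ 2) / 2 = 1 := fun i =>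
    ⟨by simpa only [rowMean, Fin.sum_univ_two, Nat.cast_ofNat] using hrow i,
      by simpa only [hrow, sub_zero, Fin.sum_univ_two] using hvar i⟩
  have hle := hmain Y hstd 0
  rw [hcol, abs_zero] at hle
  exact absurd hle (not_le.mpr (one_div_pos.mpr hpos))
end

section
/- Let I, J ≥ 3 and let X be a random I×J matrix with independent standard normal entries, so that almost surely all iterates of Efron's algorithm are defined. Then for each column index j, almost surely limsup_{m→∞} (S_j^{(2m−1)})² > 0, where (S_j^{(2m−1)})² denotes the variance (with divisor I) of the j-th column of the iterate X^{(2m−1)}; that is, the event that the column variances along the odd iterates have limit superior equal to 0 has probability zero. -/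
open Filter MeasureTheory Finset

section Standardization

variable {I J : ℕ}

/-- Every row has sum zero and mean square one. -/
def RowStandardized (Y : Fin I → Fin J → ℝ) : Prop :=
  ∀ i, ∑ j, Y i j = 0 ∧ ∑ j, Y i j ^ 2 = J

lemma rowSD_sq (X : Fin I → Fin J → ℝ) (i : Fin I) :
    rowSD X i ^ 2 = (∑ j, (X i j - rowMean X i) ^ 2) / J :=
  Real.sq_sqrt (by positivity)

lemma mul_rowMean (hJ : 0 < J) (X : Fin I → Fin J → ℝ) (i : Fin I) :
    (J : ℝ) * rowMean X i = ∑ j, X i j := by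
  have : (J : ℝ) ≠ 0 := by positivity
  unfold rowMean
  field_simp

lemma sum_sub_rowMean (hJ : 0 < J) (X : Fin I → Fin J → ℝ) (i : Fin I) :
    ∑ j, (X i j - rowMean X i) = 0 := by
  simp [Finset.sum_sub_distrib, mul_rowMean hJ]

lemma rowSD_pos_of_ne {X : Fin I → Fin J → ℝ} {i : Fin I} {k l : Fin J}
    (h : X i k ≠ X i l) : 0 < rowSD X i := by
  have hJ : (0 : ℝ) < J := by exact_mod_cast k.pos
  refine Real.sqrt_pos.mpr (div_pos ?_ hJ)
  obtain ⟨j, hj⟩ : ∃ j, X i j ≠ rowMean X i := by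
    by_contra! hc
    exact h ((hc k).trans (hc l).symm)
  exact Finset.sum_pos' (fun _ _ => sq_nonneg _)
    ⟨j, Finset.mem_univ _, by have := sub_ne_zero.mpr hj; positivity⟩

lemma exists_ne_of_rowSD_pos {X : Fin I → Fin J → ℝ} {i : Fin I} (h : 0 < rowSD X i)
    (k : Fin J) : ∃ l, X i l ≠ X i k := by
  by_contra! hc
  have hJ : (J : ℝ) ≠ 0 := by exact_mod_cast k.pos.ne'
  have hm : rowMean X i = X i k := by simp [rowMean, hc, hJ]
  simp [rowSD, hm, hc] at h

lemma rowStandardized_rowStd (hJ : 0 < J) {X : Fin I → Fin J → ℝ} (h : ∀ i, 0 < rowSD X i) :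
    RowStandardized (rowStd X) := by
  intro i
  have hi := (h i).ne'
  have hJ' : (J : ℝ) ≠ 0 := by positivity
  constructor
  · simp only [rowStd]
    rw [← Finset.sum_div, sum_sub_rowMean hJ, zero_div]
  · simp only [rowStd, div_pow]
    rw [← Finset.sum_div, div_eq_iff (by positivity), rowSD_sq]
    field_simp

lemma colMean_mul (hI : 0 < I) (Y : Fin I → Fin J → ℝ) (j : Fin J) :
    (I : ℝ) * colMean Y j = ∑ i, Y i j :=
  mul_rowMean hI (fun j i => Y i j) j

lemma sum_colMean {Y : Fin I → Fin J → ℝ} (hY : ∀ i, ∑ j, Y i j = 0) :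
    ∑ j, colMean Y j = 0 := by
  simp only [colMean]
  rw [← Finset.sum_div, Finset.sum_comm]
  simp [hY]

lemma colSD_sq_le (hI : 0 < I) {Y : Fin I → Fin J → ℝ} (hY : RowStandardized Y) (j : Fin J) :
    colSD Y j ^ 2 ≤ J := by
  have hI' : (0 : ℝ) < I := by positivity
  have hsq : colSD Y j ^ 2 = (∑ i, (Y i j - colMean Y j) ^ 2) / I :=
    rowSD_sq (fun j i => Y i j) j
  have hexp : ∑ i, (Y i j - colMean Y j) ^ 2
      = ∑ i, Y i j ^ 2 - I * colMean Y j ^ 2 := by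
    simp only [sub_sq, Finset.sum_add_distrib, Finset.sum_sub_distrib, ← Finset.sum_mul,
      ← Finset.mul_sum, ← colMean_mul hI]
    simp
    ring
  have hle : ∑ i, Y i j ^ 2 ≤ ∑ _i : Fin I, (J : ℝ) := by
    refine Finset.sum_le_sum fun i _ => ?_
    rw [← (hY i).2]
    exact Finset.single_le_sum (f := fun j => Y i j ^ 2) (fun _ _ => sq_nonneg _)
      (Finset.mem_univ j)
  rw [hsq, div_le_iff₀ hI', hexp]
  simp only [Finset.sum_const, Finset.card_univ, Fintype.card_fin, nsmul_eq_mul] at hle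
  nlinarith [mul_nonneg hI'.le (sq_nonneg (colMean Y j))]

/-- Standardizing the columns of a row-standardized matrix leaves the row variances bounded below
by the squared distances of the rows to the mean row. -/
lemma sum_sq_le_rowSD_colStd (hI : 0 < I) (hJ : 0 < J) {Y : Fin I → Fin J → ℝ}
    (hY : RowStandardized Y) (hS : ∀ j, 0 < colSD Y j) (i : Fin I) :
    ∑ j, (Y i j - colMean Y j) ^ 2 ≤ J ^ 2 * rowSD (colStd Y) i ^ 2 := by
  have hJ' : (0 : ℝ) < J := by positivity
  set v : Fin J → ℝ := fun j => Y i j - colMean Y j with hv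
  set m := rowMean (colStd Y) i with hm
  have hv0 : ∑ j, v j = 0 := by
    simp [hv, Finset.sum_sub_distrib, (hY i).1, sum_colMean fun i => (hY i).1]
  set N := ∑ j, v j ^ 2 with hN
  have hN0 : 0 ≤ N := by positivity
  have hC : (∑ j, v j * (colStd Y i j - m)) ^ 2
      ≤ N * ∑ j, (colStd Y i j - m) ^ 2 := Finset.sum_mul_sq_le_sq_mul_sq _ _ _
  have hsum : ∑ j, (colStd Y i j - m) ^ 2 = J * rowSD (colStd Y) i ^ 2 := by
    rw [rowSD_sq]; field_simp; rfl
  have hlow : N / √J ≤ ∑ j, v j * (colStd Y i j - m) := by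
    have h1 : ∑ j, v j * (colStd Y i j - m) = ∑ j, v j ^ 2 / colSD Y j := by
      simp only [mul_sub, Finset.sum_sub_distrib, ← Finset.sum_mul, hv0, zero_mul, sub_zero]
      refine Finset.sum_congr rfl fun j _ => ?_
      simp only [colStd, hv]
      ring
    rw [h1, hN, Finset.sum_div]
    refine Finset.sum_le_sum fun j _ => ?_
    exact div_le_div_of_nonneg_left (sq_nonneg _) (hS j)
      (Real.le_sqrt_of_sq_le (colSD_sq_le hI hY j))
  have hsq : N ^ 2 / J ≤ N * (J * rowSD (colStd Y) i ^ 2) := by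
    have := pow_le_pow_left₀ (by positivity) hlow 2
    rw [div_pow, Real.sq_sqrt hJ'.le] at this
    exact this.trans (hsum ▸ hC)
  rcases hN0.eq_or_lt with h0 | h0
  · rw [← h0]; positivity
  · rw [div_le_iff₀ hJ'] at hsq
    refine le_of_mul_le_mul_left ?_ h0
    linarith

lemma sum_mul_rows_le {Y : Fin I → Fin J → ℝ} (hY : RowStandardized Y) (i k : Fin I) :
    ∑ j, Y i j * Y k j ≤ J := by
  have h : 0 ≤ ∑ j, (Y i j - Y k j) ^ 2 := by positivity
  simp only [sub_sq, Finset.sum_add_distrib, Finset.sum_sub_distrib, (hY i).2, (hY k).2,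
    mul_assoc, ← Finset.mul_sum] at h
  linarith

lemma sum_mul_sub_colMean (hI : 0 < I) {Y : Fin I → Fin J → ℝ} (hY : RowStandardized Y)
    (i : Fin I) :
    I * ∑ j, Y i j * (Y i j - colMean Y j) = I * J - ∑ k, ∑ j, Y i j * Y k j := by
  rw [Finset.sum_comm]
  simp only [← Finset.mul_sum, ← colMean_mul hI, ← (hY i).2]
  rw [Finset.mul_sum, Finset.mul_sum, ← Finset.sum_sub_distrib]
  exact Finset.sum_congr rfl fun j _ => by ring

/-- Column standardization of a row-standardized matrix with nonconstant columns has no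
constant row: otherwise one row would be the mean of all rows, hence all rows would agree. -/
lemma rowSD_colStd_pos (hJ : 0 < J) {Y : Fin I → Fin J → ℝ}
    (hY : RowStandardized Y) (hS : ∀ j, 0 < colSD Y j) (i : Fin I) :
    0 < rowSD (colStd Y) i := by
  have hI : 0 < I := i.pos
  refine (Real.sqrt_nonneg _).lt_of_ne fun h0 => ?_
  have hle := sum_sq_le_rowSD_colStd hI hJ hY hS i
  have h0' : rowSD (colStd Y) i = 0 := h0.symm
  rw [h0'] at hle
  have hz : ∑ j, (Y i j - colMean Y j) ^ 2 = 0 :=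
    le_antisymm (by simpa using hle) (by positivity)
  have hz' : ∀ j, Y i j - colMean Y j = 0 := by
    intro j
    have := (Finset.sum_eq_zero_iff_of_nonneg fun _ _ => sq_nonneg _).mp hz j (Finset.mem_univ j)
    exact pow_eq_zero_iff two_ne_zero |>.mp this
  have hid := sum_mul_sub_colMean hI hY i
  simp only [hz', mul_zero, Finset.sum_const_zero] at hid
  have hd : ∑ k, ∑ j, (Y i j - Y k j) ^ 2 = 0 := by
    have : ∀ k, ∑ j, (Y i j - Y k j) ^ 2 = 2 * J - 2 * ∑ j, Y i j * Y k j := by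
      intro k
      simp only [sub_sq, Finset.sum_add_distrib, Finset.sum_sub_distrib, (hY i).2, (hY k).2,
        mul_assoc, ← Finset.mul_sum]
      ring
    simp only [this, Finset.sum_sub_distrib, ← Finset.mul_sum]
    simp
    linarith
  obtain ⟨k, hk⟩ := exists_ne_of_rowSD_pos (X := fun j i => Y i j) (hS ⟨0, hJ⟩) i
  have h1 := (Finset.sum_eq_zero_iff_of_nonneg fun _ _ => by positivity).mp hd k
    (Finset.mem_univ k)
  have h2 := (Finset.sum_eq_zero_iff_of_nonneg fun _ _ => sq_nonneg _).mp h1 ⟨0, hJ⟩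
    (Finset.mem_univ _)
  exact hk (sub_eq_zero.mp (pow_eq_zero_iff two_ne_zero |>.mp h2)).symm

/-- If the rows of a row-standardized matrix admit a linear relation with positive coefficients,
then the row variances after column standardization are bounded below. -/
lemma le_rowSD_colStd_sq (hJ : 0 < J) {Y : Fin I → Fin J → ℝ}
    (hY : RowStandardized Y) (hS : ∀ j, 0 < colSD Y j) {w : Fin I → ℝ} (hw : ∀ i, 0 < w i)
    (hrel : ∀ j, ∑ i, w i * Y i j = 0) (i : Fin I) :
    1 / ((I : ℝ) ^ 2 * J) ≤ rowSD (colStd Y) i ^ 2 := by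
  have hI : 0 < I := i.pos
  have hI' : (0 : ℝ) < I := by positivity
  have hJ' : (0 : ℝ) < J := by positivity
  obtain ⟨k, hk⟩ : ∃ k, ∑ j, Y i j * Y k j ≤ 0 := by
    by_contra! hc
    have hpos : 0 < ∑ k, w k * ∑ j, Y i j * Y k j :=
      Finset.sum_pos (fun k _ => mul_pos (hw k) (hc k)) ⟨i, Finset.mem_univ i⟩
    have hzero : ∑ k, w k * ∑ j, Y i j * Y k j = 0 := by
      simp only [Finset.mul_sum]
      rw [Finset.sum_comm]
      refine Finset.sum_eq_zero fun j _ => ?_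
      rw [← mul_zero (Y i j), ← hrel j, Finset.mul_sum]
      exact Finset.sum_congr rfl fun k _ => by ring
    exact hpos.ne' hzero
  have hrow : ∑ k, ∑ j, Y i j * Y k j ≤ I * J - J := by
    rw [← Finset.add_sum_erase _ _ (Finset.mem_univ k)]
    have h1 : ∑ k ∈ Finset.univ.erase k, ∑ j, Y i j * Y k j
        ≤ ∑ _k ∈ Finset.univ.erase k, (J : ℝ) :=
      Finset.sum_le_sum fun k _ => sum_mul_rows_le hY i k
    rw [Finset.sum_const, Finset.card_erase_of_mem (Finset.mem_univ k), Finset.card_univ,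
      Fintype.card_fin, nsmul_eq_mul, Nat.cast_pred hI] at h1
    linarith
  have hid := sum_mul_sub_colMean hI hY i
  set G := ∑ j, Y i j * (Y i j - colMean Y j) with hG
  have hG1 : (J : ℝ) ≤ I * G := by linarith
  have hC : G ^ 2 ≤ J * ∑ j, (Y i j - colMean Y j) ^ 2 := by
    have := Finset.sum_mul_sq_le_sq_mul_sq Finset.univ (Y i) fun j => Y i j - colMean Y j
    rwa [(hY i).2] at this
  have hle := sum_sq_le_rowSD_colStd hI hJ hY hS i
  have h1 : (J : ℝ) ^ 2 ≤ I ^ 2 * G ^ 2 := by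
    rw [← mul_pow]; exact pow_le_pow_left₀ hJ'.le hG1 2
  rw [div_le_iff₀ (by positivity)]
  have h2 : (J : ℝ) ^ 2 ≤ J ^ 2 * (rowSD (colStd Y) i ^ 2 * (I ^ 2 * J)) := by
    calc (J : ℝ) ^ 2 ≤ I ^ 2 * G ^ 2 := h1
      _ ≤ I ^ 2 * (J * (J ^ 2 * rowSD (colStd Y) i ^ 2)) := by gcongr; exact hC.trans (by gcongr)
      _ = _ := by ring
  have h3 : (0 : ℝ) < J ^ 2 := by positivity
  nlinarith

lemma sum_rowSD_mul_rowStd {V : Fin I → Fin J → ℝ}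
    (hV : ∀ i, 0 < rowSD V i) (hcol : ∀ j, ∑ i, V i j = 0) (j : Fin J) :
    ∑ i, rowSD V i * rowStd V i j = 0 := by
  have h1 : ∀ i, rowSD V i * rowStd V i j = V i j - rowMean V i := fun i => by
    simp only [rowStd]
    exact mul_div_cancel₀ _ (hV i).ne'
  simp only [h1, Finset.sum_sub_distrib, hcol]
  have := sum_colMean (Y := fun j i => V i j) hcol
  simpa [colMean, rowMean] using this

lemma efron_odd (X : Fin I → Fin J → ℝ) (m : ℕ) :
    efron X (2 * m + 1) = rowStd (efron X (2 * m)) := by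
  simp [efron]

lemma efron_even_succ (X : Fin I → Fin J → ℝ) (m : ℕ) :
    efron X (2 * m + 2) = colStd (efron X (2 * m + 1)) := by
  rw [efron, if_neg (by omega)]

/-- Transposed form of `rowStandardized_rowStd`. -/
lemma rowStandardized_swap_colStd (hI : 0 < I) {X : Fin I → Fin J → ℝ} (h : ∀ j, 0 < colSD X j) :
    RowStandardized fun j i => colStd X i j :=
  rowStandardized_rowStd (X := fun j i => X i j) hI h

/-- Only the first row and column standardizations can break down. -/
lemma efronDefined_of_pos (hI : 0 < I) (hJ : 0 < J) {X : Fin I → Fin J → ℝ}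
    (hR : ∀ i, 0 < rowSD X i) (hC : ∀ j, 0 < colSD (rowStd X) j) : efronDefined X := by
  have key : ∀ m, (∀ i, 0 < rowSD (efron X (2 * m)) i) ∧
      ∀ j, 0 < colSD (efron X (2 * m + 1)) j := by
    intro m
    induction m with
    | zero =>
      refine ⟨hR, ?_⟩
      rw [efron_odd]
      exact hC
    | succ m ih =>
      have hrow : ∀ i, 0 < rowSD (efron X (2 * (m + 1))) i := by
        rw [mul_add_one, efron_even_succ]
        refine rowSD_colStd_pos hJ ?_ ih.2
        rw [efron_odd]
        exact rowStandardized_rowStd hJ ih.1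
      refine ⟨hrow, fun j => ?_⟩
      rw [efron_odd]
      refine rowSD_colStd_pos (Y := fun j i => efron X (2 * (m + 1)) i j) hI ?_ hrow j
      rw [mul_add_one, efron_even_succ]
      exact rowStandardized_swap_colStd hI ih.2
  intro m
  constructor
  · intro hm
    obtain ⟨k, rfl⟩ : ∃ k, m = 2 * k := ⟨m / 2, by omega⟩
    exact (key k).1
  · intro hm
    obtain ⟨k, rfl⟩ : ∃ k, m = 2 * k + 1 := ⟨m / 2, by omega⟩
    exact (key k).2

lemma efronDefined.rowSD_pos {X : Fin I → Fin J → ℝ} (h : efronDefined X) (m : ℕ) :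
    ∀ i, 0 < rowSD (efron X (2 * m)) i :=
  (h (2 * m)).1 (by omega)

lemma efronDefined.colSD_pos {X : Fin I → Fin J → ℝ} (h : efronDefined X) (m : ℕ) :
    ∀ j, 0 < colSD (efron X (2 * m + 1)) j :=
  (h (2 * m + 1)).2 (by omega)

lemma efronDefined.rowStandardized (hJ : 0 < J) {X : Fin I → Fin J → ℝ} (h : efronDefined X)
    (m : ℕ) : RowStandardized (efron X (2 * m + 1)) := by
  rw [efron_odd]
  exact rowStandardized_rowStd hJ (h.rowSD_pos m)

lemma efronDefined.le_colSD_sq (hI : 0 < I) {X : Fin I → Fin J → ℝ}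
    (h : efronDefined X) (m : ℕ) (j : Fin J) :
    1 / ((J : ℝ) ^ 2 * I) ≤ colSD (efron X (2 * (m + 1) + 1)) j ^ 2 := by
  have hJ : 0 < J := j.pos
  have hpos := h.rowSD_pos (m + 1)
  rw [efron_odd]
  rw [mul_add_one, efron_even_succ] at hpos ⊢
  exact le_rowSD_colStd_sq (Y := fun j i => colStd (efron X (2 * m + 1)) i j) hI
    (rowStandardized_swap_colStd hI (h.colSD_pos m)) hpos (h.colSD_pos m)
    (sum_rowSD_mul_rowStd (V := fun j i => efron X (2 * m + 1) i j) (h.colSD_pos m)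
      fun i => (h.rowStandardized hJ m i).1) j

lemma efronDefined.limsup_colSD_sq_pos (hI : 0 < I) {X : Fin I → Fin J → ℝ}
    (h : efronDefined X) (j : Fin J) :
    0 < limsup (fun m : ℕ => colSD (efron X (2 * m + 1)) j ^ 2) atTop := by
  have hJ : 0 < J := j.pos
  have hc : 0 < 1 / ((J : ℝ) ^ 2 * I) := by positivity
  refine hc.trans_le (le_limsup_of_frequently_le ?_ ?_)
  · refine Eventually.frequently ?_
    filter_upwards [eventually_ge_atTop 1] with m hm
    obtain ⟨k, rfl⟩ : ∃ k, m = k + 1 := ⟨m - 1, by omega⟩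
    exact h.le_colSD_sq hI k j
  · exact isBoundedUnder_of ⟨J, fun m => colSD_sq_le hI (h.rowStandardized hJ m) j⟩

end Standardization

section NullSets

variable {ι : Type*} [Fintype ι] [DecidableEq ι] {α : ι → Type*} [∀ i, MeasurableSpace (α i)]
  {μ : ∀ i, Measure (α i)} [∀ i, SigmaFinite (μ i)]

/-- A measurable set all of whose slices in a fixed coordinate direction are null is null. -/
lemma pi_eq_zero_of_slices {s : Set (∀ i, α i)} (hs : MeasurableSet s) (i : ι)
    (h : ∀ x, μ i {t | Function.update x i t ∈ s} = 0) : Measure.pi μ s = 0 := by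
  rcases isEmpty_or_nonempty (∀ i, α i) with he | ⟨⟨x⟩⟩
  · rw [Set.eq_empty_of_isEmpty s, measure_empty]
  · have hf : Measurable (s.indicator (1 : (∀ i, α i) → ENNReal)) := measurable_one.indicator hs
    rw [← lintegral_indicator_one hs, lintegral_eq_lmarginal_univ x,
      lmarginal_erase' _ hf (Finset.mem_univ i)]
    have hz : ∀ x, ∫⁻ t, s.indicator (1 : (∀ i, α i) → ENNReal) (Function.update x i t) ∂μ i
        = 0 := by
      intro x
      have hm : MeasurableSet {t | Function.update x i t ∈ s} := measurable_update x hs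
      rw [← h x, ← lintegral_indicator_one hm]
      rfl
    simp only [hz]
    simp [lmarginal]

lemma pi_eq_zero_of_subsingleton_slices [∀ i, NullSingletonClass (μ i)] {s : Set (∀ i, α i)}
    (hs : MeasurableSet s) (i : ι)
    (h : ∀ x, {t | Function.update x i t ∈ s}.Subsingleton) : Measure.pi μ s = 0 :=
  pi_eq_zero_of_slices hs i fun x => (h x).measure_zero _

end NullSets

lemma injective_div_sqrt {a b : ℝ} (ha : 0 ≤ a) (hb : 0 < b) :
    Function.Injective fun u : ℝ => u / √(a * u ^ 2 + b) := by
  intro u v h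
  have hu : 0 < a * u ^ 2 + b := by positivity
  have hv : 0 < a * v ^ 2 + b := by positivity
  have hu' := Real.sqrt_pos.mpr hu
  have hv' := Real.sqrt_pos.mpr hv
  have h' : u * √(a * v ^ 2 + b) = v * √(a * u ^ 2 + b) :=
    (div_eq_div_iff hu'.ne' hv'.ne').mp h
  have hsq := congrArg (· ^ 2) h'
  simp only [mul_pow, Real.sq_sqrt hu.le, Real.sq_sqrt hv.le] at hsq
  have huv : u ^ 2 = v ^ 2 := mul_right_cancel₀ hb.ne' (by linarith)
  rw [huv] at h'
  exact mul_right_cancel₀ hv'.ne' h'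

section Gaussian

open ProbabilityTheory

variable {I J : ℕ}

/-- As a function of one entry, a standardized row entry is injective as soon as the remaining
entries of that row are not all equal. -/
lemma rowStd_update_injective {X : Fin I → Fin J → ℝ} {i : Fin I} {j k l : Fin J}
    (hk : k ≠ j) (hl : l ≠ j) (h : X i k ≠ X i l) :
    Function.Injective fun t => rowStd (Function.update X i (Function.update (X i) j t)) i j := by
  have hJ0 : 0 < J := j.pos
  have hJ : (0 : ℝ) < J := by positivity
  have hJ2 : (1 : ℝ) < J := by
    have : 1 < J := by have := Fin.val_ne_of_ne hk; omega
    exact_mod_cast this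
  set n : ℝ := J - 1 with hn
  have hn0 : 0 < n := by linarith
  set E := Finset.univ.erase j with hE
  have hcard : ∑ _x ∈ E, (1 : ℝ) = n := by
    simp [hE, Finset.card_erase_of_mem, Nat.cast_pred hJ0, hn]
  set o := (∑ x ∈ E, X i x) / n with ho
  set W := ∑ x ∈ E, (X i x - o) ^ 2 with hW
  have hW0 : 0 < W := by
    obtain ⟨q, hq, hqo⟩ : ∃ q ∈ E, X i q ≠ o := by
      by_contra! hc
      exact h ((hc k (by simp [hE, hk])).trans (hc l (by simp [hE, hl])).symm)
    exact Finset.sum_pos' (fun _ _ => sq_nonneg _)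
      ⟨q, hq, by have := sub_ne_zero.mpr hqo; positivity⟩
  have ho' : ∑ x ∈ E, (X i x - o) = 0 := by
    have : ∑ x ∈ E, o = n * o := by rw [← hcard, Finset.sum_mul]; simp
    rw [Finset.sum_sub_distrib, this, ho]
    field_simp
    ring
  have key : ∀ t, rowStd (Function.update X i (Function.update (X i) j t)) i j
      = n / J * ((t - o) / √(n / J ^ 2 * (t - o) ^ 2 + W / J)) := by
    intro t
    set Z := Function.update X i (Function.update (X i) j t) with hZ
    have hZj : Z i j = t := by simp [hZ]
    have hZE : ∀ x ∈ E, Z i x = X i x := fun x hx => by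
      simp [hZ, Finset.ne_of_mem_erase hx]
    have hm : rowMean Z i = o + (t - o) / J := by
      have hs : ∑ x, Z i x = t + n * o := by
        rw [← Finset.add_sum_erase _ _ (Finset.mem_univ j), hZj, Finset.sum_congr rfl hZE, ho]
        field_simp
      rw [rowMean, hs, hn]
      field_simp
      ring
    have hv : ∑ x, (Z i x - rowMean Z i) ^ 2 = n / J * (t - o) ^ 2 + W := by
      have h1 : ∀ x ∈ E, (Z i x - rowMean Z i) ^ 2
          = (X i x - o) ^ 2 - 2 * ((t - o) / J) * (X i x - o) + ((t - o) / J) ^ 2 * 1 := by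
        intro x hx
        rw [hZE x hx, hm]
        ring
      rw [← Finset.add_sum_erase _ _ (Finset.mem_univ j), hZj, Finset.sum_congr rfl h1,
        Finset.sum_add_distrib, Finset.sum_sub_distrib, ← Finset.mul_sum, ← Finset.mul_sum, ho',
        hcard, hm, hn]
      field_simp
      ring
    rw [rowStd, rowSD, hv, hZj, hm, add_div, hn]
    have h2 : ((J : ℝ) - 1) / J * (t - o) ^ 2 / J = (J - 1) / J ^ 2 * (t - o) ^ 2 := by
      field_simp
    rw [h2, ← mul_div_assoc]
    congr 1
    field_simp
    ring
  intro t u htu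
  simp only [key] at htu
  have h1 := mul_left_cancel₀ (by positivity) htu
  have h2 := injective_div_sqrt (a := n / (J : ℝ) ^ 2) (b := W / J) (by positivity)
    (by positivity) h1
  linarith

lemma measurable_rowMean (i : Fin I) :
    Measurable fun X : Fin I → Fin J → ℝ => rowMean X i := by
  unfold rowMean
  fun_prop

lemma measurable_rowStd (i : Fin I) (j : Fin J) :
    Measurable fun X : Fin I → Fin J → ℝ => rowStd X i j := by
  have := measurable_rowMean (J := J) i
  unfold rowStd rowSD
  fun_prop

instance : NullSingletonClass (gaussianReal 0 1) :=
  nullSingletonClass_gaussianReal one_ne_zero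

/-- Almost surely, distinct entries of a row of a Gaussian matrix differ. -/
lemma ae_entry_ne (i : Fin I) {k l : Fin J} (hkl : k ≠ l) :
    ∀ᵐ X : Fin I → Fin J → ℝ ∂(Measure.pi fun _ : Fin I => Measure.pi fun _ : Fin J =>
      gaussianReal 0 1), X i k ≠ X i l := by
  have hmeas : MeasurableSet {X : Fin I → Fin J → ℝ | X i k = X i l} :=
    measurableSet_eq_fun (by fun_prop) (by fun_prop)
  refine measure_eq_zero_iff_ae_notMem.mp (pi_eq_zero_of_slices hmeas i fun X => ?_)
  refine pi_eq_zero_of_subsingleton_slices (measurable_update X hmeas) k fun x t ht u hu => ?_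
  have hval : ∀ t, Function.update X i (Function.update x k t) i k
      = Function.update X i (Function.update x k t) i l → t = x l := fun t h => by
    simpa [hkl.symm] using h
  exact (hval t ht).trans (hval u hu).symm

lemma ae_rowStd_ne {i i' : Fin I} (hi : i' ≠ i) {j k l : Fin J}
    (hk : k ≠ j) (hl : l ≠ j) (hkl : k ≠ l) :
    ∀ᵐ X : Fin I → Fin J → ℝ ∂(Measure.pi fun _ : Fin I => Measure.pi fun _ : Fin J =>
      gaussianReal 0 1), rowStd X i j ≠ rowStd X i' j := by
  have hnull : (Measure.pi fun _ : Fin I => Measure.pi fun _ : Fin J => gaussianReal 0 1)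
      {X : Fin I → Fin J → ℝ | rowStd X i j = rowStd X i' j ∧ X i k ≠ X i l} = 0 := by
    have hmeas : MeasurableSet
        {X : Fin I → Fin J → ℝ | rowStd X i j = rowStd X i' j ∧ X i k ≠ X i l} :=
      (measurableSet_eq_fun (measurable_rowStd i j) (measurable_rowStd i' j)).inter
        (measurableSet_eq_fun (f := fun X : Fin I → Fin J → ℝ => X i k)
          (g := fun X => X i l) (by fun_prop) (by fun_prop)).compl
    refine pi_eq_zero_of_slices hmeas i fun X => ?_
    refine pi_eq_zero_of_subsingleton_slices (measurable_update X hmeas) j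
      fun x t ht u hu => ?_
    obtain ⟨ht, hne⟩ := ht
    have hu := hu.1
    have hrow : ∀ Y : Fin J → ℝ, rowStd (Function.update X i Y) i' j = rowStd X i' j := by
      intro Y
      simp [rowStd, rowSD, rowMean, hi]
    rw [hrow] at ht hu
    refine rowStd_update_injective (X := Function.update X i x) (i := i) hk hl ?_ ?_
    · simpa [hk, hl] using hne
    · simpa using ht.trans hu.symm
  filter_upwards [ae_entry_ne i hkl, measure_eq_zero_iff_ae_notMem.mp hnull] with X h1 h2 h3
  exact h2 ⟨h3, h1⟩

lemma ae_efronDefined (hI : 3 ≤ I) (hJ : 3 ≤ J) :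
    ∀ᵐ X : Fin I → Fin J → ℝ ∂(Measure.pi fun _ : Fin I => Measure.pi fun _ : Fin J =>
      gaussianReal 0 1), efronDefined X := by
  have hI0 : 0 < I := by omega
  have hJ0 : 0 < J := by omega
  let a : Fin I := ⟨0, hI0⟩
  let b : Fin I := ⟨1, by omega⟩
  have hba : b ≠ a := by simp [a, b, Fin.ext_iff]
  let c : Fin J := ⟨0, hJ0⟩
  let d : Fin J := ⟨1, by omega⟩
  have hcd : c ≠ d := by simp [c, d, Fin.ext_iff]
  have hrow := ae_all_iff.mpr fun i : Fin I => ae_entry_ne i hcd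
  have hcol : ∀ᵐ X : Fin I → Fin J → ℝ ∂(Measure.pi fun _ : Fin I => Measure.pi fun _ : Fin J =>
      gaussianReal 0 1), ∀ j, rowStd X a j ≠ rowStd X b j := by
    refine ae_all_iff.mpr fun j => ?_
    obtain ⟨k, l, hk, hl, hkl⟩ : ∃ k l : Fin J, k ≠ j ∧ l ≠ j ∧ k ≠ l := by
      have : 1 < (Finset.univ.erase j).card := by
        rw [Finset.card_erase_of_mem (Finset.mem_univ j), Finset.card_univ, Fintype.card_fin]
        omega
      obtain ⟨k, hk, l, hl, hkl⟩ := Finset.one_lt_card.mp this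
      exact ⟨k, l, Finset.ne_of_mem_erase hk, Finset.ne_of_mem_erase hl, hkl⟩
    exact ae_rowStd_ne hba hk hl hkl
  filter_upwards [hrow, hcol] with X h1 h2
  exact efronDefined_of_pos hI0 hJ0 (fun i => rowSD_pos_of_ne (h1 i))
    fun j => rowSD_pos_of_ne (X := fun j i => rowStd X i j) (h2 j)

end Gaussian

/-- For a random `I × J` matrix (`I, J ≥ 3`) with independent standard
normal entries, almost surely all iterates of Efron's algorithm are defined, and for each
column `j`, almost surely the column variances `(S_j^{(2m+1)})²` of the odd iterates have
strictly positive limit superior. -/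
theorem col_variance_limsup_pos {I J : ℕ} (hI : 3 ≤ I) (hJ : 3 ≤ J) :
    (∀ᵐ X : Fin I → Fin J → ℝ
        ∂(Measure.pi fun _ : Fin I => Measure.pi fun _ : Fin J =>
          ProbabilityTheory.gaussianReal 0 1), efronDefined X) ∧
    (∀ j : Fin J, ∀ᵐ X : Fin I → Fin J → ℝ
        ∂(Measure.pi fun _ : Fin I => Measure.pi fun _ : Fin J =>
          ProbabilityTheory.gaussianReal 0 1),
      0 < Filter.limsup (fun m : ℕ => (colSD (efron X (2 * m + 1)) j) ^ 2) atTop) := by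
  have h := ae_efronDefined hI hJ
  refine ⟨h, fun j => ?_⟩
  filter_upwards [h] with X hX
  exact hX.limsup_colSD_sq_pos (by omega) j
end
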